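/- Let G be a strongly connected digraph on n vertices with no self-loops (for every ordered pair of vertices i, j there is a directed path from i to j), and fix weights a_{ij} > 0 for j ∈ N_i. Then there exists k1* > 0 such that for every gain k1 > k1*, the feedback u_i = ‖f_i(x)‖·(R(θ_i)⁻¹f_i(x))·e1, ω_i = −k1 (R(θ_i)⁻¹f_i(x))·e2 solves the rendezvous control problem for the closed-loop unicycle system: for every ε > 0 there is δ > 0 such that every solution with D(x(0)) < δ satisfies D(x(t)) < ε on its interval of existence, every maximal solution is defined on all of [0,∞), and D(x(t)) → 0 as t → ∞ along every such solution. -/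

import Mathlib

open Matrix
open scoped BigOperators ENNReal

/-- The rotation matrix `R(θ)`. -/
noncomputable def rotM (θ : ℝ) : Matrix (Fin 2) (Fin 2) ℝ :=
  !![Real.cos θ, -Real.sin θ; Real.sin θ, Real.cos θ]

/-- Euclidean norm on ℝ². -/
noncomputable def enorm2 (v : Fin 2 → ℝ) : ℝ :=
  Real.sqrt (v 0 ^ 2 + v 1 ^ 2)

/-- The linear consensus vector field `f_i(x) = Σ_{j∈N_i} a_{ij}(x_j - x_i)`. -/
noncomputable def fcons {n : ℕ} (Adj : Fin n → Fin n → Bool) (a : Fin n → Fin n → ℝ)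
    (x : Fin n → Fin 2 → ℝ) (i : Fin n) : Fin 2 → ℝ :=
  ∑ j : Fin n, if Adj i j = true then a i j • (x j - x i) else 0

/-- The linear speed feedback `u_i = ‖f_i(x)‖ · (R(θᵢ)⁻¹ f_i(x)) · e1`. -/
noncomputable def uFB {n : ℕ} (Adj : Fin n → Fin n → Bool) (a : Fin n → Fin n → ℝ)
    (x : Fin n → Fin 2 → ℝ) (θi : ℝ) (i : Fin n) : ℝ :=
  enorm2 (fcons Adj a x i) * (((rotM θi)⁻¹ *ᵥ fcons Adj a x i) 0)

/-- The angular speed feedback `ω_i = -k1 (R(θᵢ)⁻¹ f_i(x)) · e2`. -/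
noncomputable def omegaFB {n : ℕ} (k1 : ℝ) (Adj : Fin n → Fin n → Bool)
    (a : Fin n → Fin n → ℝ) (x : Fin n → Fin 2 → ℝ) (θi : ℝ) (i : Fin n) : ℝ :=
  -k1 * (((rotM θi)⁻¹ *ᵥ fcons Adj a x i) 1)

/-- `(x, θ)` is a solution of the closed-loop unicycle system on `[0, T)`. -/
def IsSolOn {n : ℕ} (Adj : Fin n → Fin n → Bool) (a : Fin n → Fin n → ℝ) (k1 : ℝ)
    (x : ℝ → Fin n → Fin 2 → ℝ) (θ : ℝ → Fin n → ℝ) (T : ℝ≥0∞) : Prop :=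
  ∀ t : ℝ, 0 ≤ t → ENNReal.ofReal t < T → ∀ i : Fin n,
    HasDerivWithinAt (fun s => x s i)
      (uFB Adj a (x t) (θ t i) i • (rotM (θ t i) *ᵥ ![1, 0])) (Set.Ici 0) t ∧
    HasDerivWithinAt (fun s => θ s i) (omegaFB k1 Adj a (x t) (θ t i) i) (Set.Ici 0) t

/-- A maximal solution: a solution on `[0, T)` admitting no proper extension. -/
def IsMaxSol {n : ℕ} (Adj : Fin n → Fin n → Bool) (a : Fin n → Fin n → ℝ) (k1 : ℝ)
    (x : ℝ → Fin n → Fin 2 → ℝ) (θ : ℝ → Fin n → ℝ) (T : ℝ≥0∞) : Prop :=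
  IsSolOn Adj a k1 x θ T ∧
    ∀ (x' : ℝ → Fin n → Fin 2 → ℝ) (θ' : ℝ → Fin n → ℝ) (T' : ℝ≥0∞),
      T < T' → IsSolOn Adj a k1 x' θ' T' →
        ¬(∀ t : ℝ, 0 ≤ t → ENNReal.ofReal t < T → x' t = x t ∧ θ' t = θ t)

/-- `D(x) = max_{i,j} ‖x_i - x_j‖`. -/
noncomputable def Dmax {n : ℕ} (x : Fin n → Fin 2 → ℝ) : ℝ :=
  ⨆ i : Fin n, ⨆ j : Fin n, enorm2 (x i - x j)

section Continuation

open Set Filter Topology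
open scoped NNReal

variable {E : Type*} [NormedAddCommGroup E] [NormedSpace ℝ E] [CompleteSpace E]

/-- Local existence for an autonomous ODE with a locally Lipschitz vector field. -/
theorem LocallyLipschitz.exists_hasDerivWithinAt_Icc {F : E → E} (hF : LocallyLipschitz F)
    (t₀ : ℝ) (z₀ : E) :
    ∃ ε > 0, ∃ y : ℝ → E, y t₀ = z₀ ∧
      ∀ t ∈ Icc (t₀ - ε) (t₀ + ε), HasDerivWithinAt y (F (y t)) (Icc (t₀ - ε) (t₀ + ε)) t := by
  obtain ⟨K, s, hs, hl⟩ := hF z₀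
  obtain ⟨a, ha, has⟩ := Metric.nhds_basis_closedBall.mem_iff.mp hs
  have hb (z : E) (hz : z ∈ Metric.closedBall z₀ a) : ‖F z‖ ≤ K * a + ‖F z₀‖ + 1 := by
    have h1 := hl.norm_sub_le (has hz) (mem_of_mem_nhds hs)
    have h2 : (K : ℝ) * ‖z - z₀‖ ≤ K * a := by
      gcongr
      exact mem_closedBall_iff_norm.mp hz
    have h3 := norm_le_norm_sub_add (F z) (F z₀)
    linarith
  have hL : 0 < K * a + ‖F z₀‖ + 1 := by positivity
  have hε : 0 < a / (K * a + ‖F z₀‖ + 1) := by positivity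
  have hpl : IsPicardLindelof (fun _ => F)
      (tmin := t₀ - a / (K * a + ‖F z₀‖ + 1)) (tmax := t₀ + a / (K * a + ‖F z₀‖ + 1))
      ⟨t₀, by constructor <;> linarith⟩ z₀ (.mk a ha.le) 0 (.mk _ hL.le) K := by
    refine IsPicardLindelof.of_time_independent hb (hl.mono has) ?_
    simp [mul_div_cancel₀ _ hL.ne']
  obtain ⟨y, hy, hy'⟩ := hpl.exists_eq_forall_mem_Icc_hasDerivWithinAt₀
  exact ⟨_, hε, y, hy, hy'⟩

/-- A curve with bounded derivative on `[0, T)` has a limit at `T`. -/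
theorem exists_tendsto_nhdsLT_of_hasDerivWithinAt_bounded {z z' : ℝ → E} {T C : ℝ}
    (hz : ∀ t ∈ Ico 0 T, HasDerivWithinAt z (z' t) (Ici 0) t)
    (hC : ∀ t ∈ Ico 0 T, ‖z' t‖ ≤ C) (hT : 0 < T) :
    ∃ l, Tendsto z (𝓝[<] T) (𝓝 l) := by
  have hlip : LipschitzOnWith C.toNNReal z (Ico 0 T) :=
    (convex_Ico 0 T).lipschitzOnWith_of_nnnorm_hasDerivWithin_le
      (fun t ht => (hz t ht).mono fun s hs => hs.1)
      (fun t ht => by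
        rw [← NNReal.coe_le_coe]
        exact (hC t ht).trans (Real.le_coe_toNNReal C))
  refine cauchy_map_iff_exists_tendsto.mp
    (cauchy_nhds.mono nhdsWithin_le_nhds |>.map_of_le hlip.uniformContinuousOn ?_)
  exact le_principal_iff.mpr (Ico_mem_nhdsLT hT)

/-- A solution of an autonomous ODE on `[0, T)` whose velocity is bounded extends beyond `T`. -/
theorem LocallyLipschitz.exists_extension {F : E → E} (hF : LocallyLipschitz F)
    {z : ℝ → E} {T C : ℝ} (hT : 0 ≤ T)
    (hz : ∀ t ∈ Ico 0 T, HasDerivWithinAt z (F (z t)) (Ici 0) t)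
    (hC : ∀ t ∈ Ico 0 T, ‖F (z t)‖ ≤ C) :
    ∃ ε > 0, ∃ y : ℝ → E, (∀ t ∈ Ico 0 T, y t = z t) ∧
      ∀ t ∈ Ico 0 (T + ε), HasDerivWithinAt y (F (y t)) (Ici 0) t := by
  obtain ⟨l, hl⟩ : ∃ l, 0 < T → Tendsto z (𝓝[<] T) (𝓝 l) := by
    rcases hT.eq_or_lt with h | h
    · exact ⟨0, fun h' => absurd h h'.ne⟩
    · obtain ⟨l, hl⟩ := exists_tendsto_nhdsLT_of_hasDerivWithinAt_bounded hz hC h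
      exact ⟨l, fun _ => hl⟩
  obtain ⟨ε, hε, y, hyT, hy⟩ := hF.exists_hasDerivWithinAt_Icc T l
  set Y : ℝ → E := fun t => if t < T then z t else y t with hY
  have hYlt (t : ℝ) (ht : t < T) : Y t = z t := by simp [hY, ht]
  have hYge (t : ℝ) (ht : T ≤ t) : Y t = y t := by simp [hY, not_lt.mpr ht]
  have hleft (t : ℝ) (ht : t ∈ Ico 0 T) : HasDerivWithinAt Y (F (Y t)) (Ici 0) t := by
    rw [hYlt t ht.2]
    refine (hz t ht).congr_of_eventuallyEq ?_ (hYlt t ht.2)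
    filter_upwards [mem_nhdsWithin_of_mem_nhds (Iio_mem_nhds ht.2)] with s hs using hYlt s hs
  refine ⟨ε, hε, Y, fun t ht => hYlt t ht.2, fun t ht => ?_⟩
  rcases lt_trichotomy t T with h | h | h
  · exact hleft t ⟨ht.1, h⟩
  · subst h
    have hr : HasDerivWithinAt Y (F (Y t)) (Ici t) t := by
      rw [hYge t le_rfl]
      have h1 : HasDerivWithinAt y (F (y t)) (Icc t (t + ε)) t :=
        (hy t ⟨by linarith, by linarith⟩).mono (Icc_subset_Icc_left (by linarith))
      have h2 : HasDerivWithinAt y (F (y t)) (Ici t) t :=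
        h1.mono_of_mem_nhdsWithin (Icc_mem_nhdsGE (by linarith))
      exact h2.congr (fun s hs => hYge s hs) (hYge t le_rfl)
    rcases hT.eq_or_lt with h0 | h0
    · rwa [← h0] at hr ⊢
    · have hcont : Tendsto Y (𝓝[<] t) (𝓝 (Y t)) := by
        rw [hYge t le_rfl, hyT]
        refine (hl h0).congr' ?_
        filter_upwards [self_mem_nhdsWithin] with s hs using (hYlt s hs).symm
      have hd (s : ℝ) (hs : s ∈ Ioo 0 t) : HasDerivAt Y (F (Y s)) s :=
        (hleft s ⟨hs.1.le, hs.2⟩).hasDerivAt (Ici_mem_nhds hs.1)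
      have hmem : Ioo 0 t ∈ 𝓝[<] t := Ioo_mem_nhdsLT h0
      have hlft : HasDerivWithinAt Y (F (Y t)) (Iic t) t := by
        refine hasDerivWithinAt_Iic_of_tendsto_deriv (s := Ioo 0 t)
          (fun s hs => (hd s hs).differentiableAt.differentiableWithinAt)
          (hcont.mono_left (nhdsWithin_mono _ fun s hs => hs.2)) hmem ?_
        refine ((hF.continuous.tendsto _).comp hcont).congr' ?_
        filter_upwards [hmem] with s hs using (hd s hs).deriv.symm
      refine (hlft.union hr).mono ?_
      simp
  · have h1 : HasDerivAt y (F (y t)) t :=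
      (hy t ⟨by linarith, ht.2.le⟩).hasDerivAt (Icc_mem_nhds (by linarith) ht.2)
    rw [hYge t h.le]
    refine (h1.congr_of_eventuallyEq ?_).hasDerivWithinAt
    filter_upwards [Ioi_mem_nhds h] with s hs using hYge s (le_of_lt hs)

end Continuation

section WeightedGraph

open Finset

variable {ι : Type*} [Fintype ι] {w : ι → ι → ℝ}

/-- A strongly connected weighted digraph has a positive left null vector of its Laplacian. -/
theorem exists_pos_left_null_laplacian (hw : ∀ i j, 0 ≤ w i j)
    (hsc : ∀ i j, Relation.ReflTransGen (fun p q => 0 < w p q) i j) :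
    ∃ γ : ι → ℝ, (∀ i, 0 < γ i) ∧ ∀ j, ∑ i, γ i * w i j = γ j * ∑ i, w j i := by
  classical
  rcases isEmpty_or_nonempty ι with h | h
  · exact ⟨fun _ => 1, fun i => h.elim i, fun i => h.elim i⟩
  obtain ⟨v, hv0, hv⟩ : ∃ v ≠ 0,
      v ᵥ* (Matrix.diagonal (fun i => ∑ k, w i k) - Matrix.of w) = 0 := by
    rw [Matrix.exists_vecMul_eq_zero_iff, ← Matrix.exists_mulVec_eq_zero_iff]
    refine ⟨fun _ => 1, fun h0 => one_ne_zero (congrFun h0 (Classical.arbitrary ι)), ?_⟩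
    ext i
    simp [Matrix.mulVec, dotProduct, Matrix.diagonal_apply]
  have hv' (j : ι) : ∑ i, v i * w i j = v j * ∑ i, w j i := by
    have := congrFun hv j
    simp only [Matrix.vecMul, dotProduct, Matrix.sub_apply, Matrix.diagonal_apply,
      Matrix.of_apply, mul_sub, sum_sub_distrib, mul_ite, mul_zero, sum_ite_eq', mem_univ,
      if_true, Pi.zero_apply] at this
    linarith
  have hle (j : ι) : |v j| * ∑ i, w j i ≤ ∑ i, |v i| * w i j := by
    calc |v j| * ∑ i, w j i = |∑ i, v i * w i j| := by
          rw [hv' j, abs_mul, abs_of_nonneg (sum_nonneg fun i _ => hw j i)]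
      _ ≤ ∑ i, |v i * w i j| := abs_sum_le_sum_abs _ _
      _ = ∑ i, |v i| * w i j := by simp only [abs_mul, abs_of_nonneg (hw _ _)]
  have hsum : ∑ j, |v j| * ∑ i, w j i = ∑ j, ∑ i, |v i| * w i j := by
    rw [sum_comm]
    simp only [mul_sum]
  have heq (j : ι) : |v j| * ∑ i, w j i = ∑ i, |v i| * w i j :=
    (sum_eq_sum_iff_of_le fun j _ => hle j).mp hsum j (mem_univ j)
  refine ⟨fun i => |v i|, fun i => abs_pos.mpr fun hi => hv0 ?_, fun j => (heq j).symm⟩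
  ext p
  refine Relation.ReflTransGen.head_induction_on (motive := fun q _ => v q = 0) (hsc p i) hi ?_
  intro p q hpq _ hq
  have h1 := heq q
  rw [hq, abs_zero, zero_mul, eq_comm,
    sum_eq_zero_iff_of_nonneg fun i _ => mul_nonneg (abs_nonneg _) (hw _ _)] at h1
  simpa [hpq.ne'] using h1 p (mem_univ p)

/-- The Dirichlet form of a weight-balanced Laplacian. -/
theorem sum_mul_laplacian_eq_neg_dirichlet {γ : ι → ℝ}
    (hγ : ∀ j, ∑ i, γ i * w i j = γ j * ∑ i, w j i) (u : ι → ℝ) :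
    ∑ i, ∑ j, γ i * w i j * (u i * (u j - u i)) =
      -(1 / 2) * ∑ i, ∑ j, γ i * w i j * (u j - u i) ^ 2 := by
  have h1 : ∑ i, ∑ j, γ i * w i j * u j ^ 2 = ∑ i, ∑ j, γ i * w i j * u i ^ 2 := by
    rw [sum_comm]
    refine sum_congr rfl fun j _ => ?_
    rw [← sum_mul, hγ j, ← sum_mul, mul_sum]
  have h2 : ∑ i, ∑ j, γ i * w i j * (u i * (u j - u i)) =
      -(1 / 2) * (∑ i, ∑ j, γ i * w i j * (u j - u i) ^ 2)
        + (1 / 2) * (∑ i, ∑ j, γ i * w i j * u j ^ 2)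
        - (1 / 2) * ∑ i, ∑ j, γ i * w i j * u i ^ 2 := by
    simp only [mul_sum, ← sum_add_distrib, ← sum_sub_distrib]
    refine sum_congr rfl fun i _ => sum_congr rfl fun j _ => ?_
    ring
  rw [h2, h1]
  ring

/-- A function with vanishing Dirichlet form on a strongly connected digraph is constant. -/
theorem eq_of_dirichlet_eq_zero {γ : ι → ℝ} (hw : ∀ i j, 0 ≤ w i j) (hpos : ∀ i, 0 < γ i)
    (hsc : ∀ i j, Relation.ReflTransGen (fun p q => 0 < w p q) i j) {u : ι → ℝ}
    (hu : ∑ i, ∑ j, γ i * w i j * (u j - u i) ^ 2 = 0) (i j : ι) : u i = u j := by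
  have hnn (i j : ι) : 0 ≤ γ i * w i j * (u j - u i) ^ 2 :=
    mul_nonneg (mul_nonneg (hpos i).le (hw i j)) (sq_nonneg _)
  refine Relation.ReflTransGen.head_induction_on (motive := fun q _ => u q = u j) (hsc i j) rfl ?_
  intro p q hpq _ hq
  rw [sum_eq_zero_iff_of_nonneg fun i _ => sum_nonneg fun j _ => hnn i j] at hu
  have h1 := hu p (mem_univ p)
  rw [sum_eq_zero_iff_of_nonneg fun j _ => hnn p j] at h1
  have h2 := h1 q (mem_univ q)
  have h3 : u q - u p = 0 := by
    simpa [(hpos p).ne', hpq.ne'] using h2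
  linarith

end WeightedGraph

/-- A continuous homogeneous function that is positive on a closed cone away from the origin
dominates a power of the norm on that cone. -/
theorem exists_pos_mul_norm_pow_le {E : Type*} [NormedAddCommGroup E] [NormedSpace ℝ E]
    [ProperSpace E] {K : Set E} (hK : IsClosed K) (hcone : ∀ r : ℝ, ∀ x ∈ K, r • x ∈ K)
    {F : E → ℝ} (hF : Continuous F) {d : ℕ} (hd : d ≠ 0)
    (hhom : ∀ r : ℝ, 0 < r → ∀ x, F (r • x) = r ^ d * F x) (hnonneg : 0 ≤ F 0)
    (hpos : ∀ x ∈ K, x ≠ 0 → 0 < F x) :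
    ∃ c > 0, ∀ x ∈ K, c * ‖x‖ ^ d ≤ F x := by
  have hcomp : IsCompact (Metric.sphere (0 : E) 1 ∩ K) := (isCompact_sphere 0 1).inter_right hK
  obtain ⟨c, hc, hcF⟩ : ∃ c > 0, ∀ x ∈ Metric.sphere (0 : E) 1 ∩ K, c ≤ F x := by
    rcases (Metric.sphere (0 : E) 1 ∩ K).eq_empty_or_nonempty with h | h
    · exact ⟨1, one_pos, by simp [h]⟩
    · obtain ⟨y, hy, hmin⟩ := hcomp.exists_isMinOn h hF.continuousOn
      refine ⟨F y, hpos y hy.2 fun h0 => ?_, hmin⟩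
      simp [h0] at hy
  refine ⟨c, hc, fun x hx => ?_⟩
  rcases eq_or_ne x 0 with rfl | h0
  · simpa [hd] using hnonneg
  · have hn : 0 < ‖x‖ := norm_pos_iff.mpr h0
    have h1 := hcF (‖x‖⁻¹ • x) ⟨by simp [norm_smul, hn.ne'], hcone _ _ hx⟩
    rw [hhom _ (inv_pos.mpr hn), inv_pow] at h1
    have h2 := mul_le_mul_of_nonneg_right h1 (pow_nonneg hn.le d)
    rwa [mul_right_comm, inv_mul_cancel₀ (pow_pos hn d).ne', one_mul] at h2

section PlanarNorm

theorem enorm2_nonneg (v : Fin 2 → ℝ) : 0 ≤ enorm2 v := Real.sqrt_nonneg _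

theorem enorm2_sq (v : Fin 2 → ℝ) : enorm2 v ^ 2 = v 0 ^ 2 + v 1 ^ 2 :=
  Real.sq_sqrt (by positivity)

theorem continuous_enorm2 : Continuous enorm2 := by
  unfold enorm2
  fun_prop

theorem enorm2_smul (r : ℝ) (v : Fin 2 → ℝ) : enorm2 (r • v) = |r| * enorm2 v := by
  have h : (r • v) 0 ^ 2 + (r • v) 1 ^ 2 = r ^ 2 * (v 0 ^ 2 + v 1 ^ 2) := by
    simp only [Pi.smul_apply, smul_eq_mul]
    ring
  rw [enorm2, h, Real.sqrt_mul (sq_nonneg r), Real.sqrt_sq_eq_abs, enorm2]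

theorem abs_apply_le_enorm2 (v : Fin 2 → ℝ) (k : Fin 2) : |v k| ≤ enorm2 v := by
  refine abs_le_of_sq_le_sq ?_ (enorm2_nonneg v)
  rw [enorm2_sq]
  fin_cases k <;> simp <;> positivity

theorem enorm2_le_two_mul_norm (v : Fin 2 → ℝ) : enorm2 v ≤ 2 * ‖v‖ := by
  have h (k : Fin 2) : v k ^ 2 ≤ ‖v‖ ^ 2 := by
    rw [sq_le_sq, abs_norm]
    exact norm_le_pi_norm v k
  refine (le_abs_self _).trans (abs_le_of_sq_le_sq ?_ (by positivity))
  rw [enorm2_sq]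
  nlinarith [h 0, h 1, sq_nonneg ‖v‖]

theorem enorm2_eq_norm_toLp (v : Fin 2 → ℝ) : enorm2 v = ‖WithLp.toLp 2 v‖ := by
  simp [enorm2, EuclideanSpace.norm_eq]

theorem abs_enorm2_sub_le (u v : Fin 2 → ℝ) : |enorm2 u - enorm2 v| ≤ 2 * ‖u - v‖ := by
  refine le_trans ?_ (enorm2_le_two_mul_norm (u - v))
  simp only [enorm2_eq_norm_toLp, WithLp.toLp_sub]
  exact abs_norm_sub_norm_le _ _

end PlanarNorm

section Coercivity

open Finset

variable {ι : Type*} [Fintype ι] {w : ι → ι → ℝ} {γ : ι → ℝ}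

/-- The Dirichlet form of `i ↦ ‖f i‖ • f i` is coercive on fields of zero weighted mean. -/
theorem exists_coercivity_const (hw : ∀ i j, 0 ≤ w i j) (hpos : ∀ i, 0 < γ i)
    (hsc : ∀ i j, Relation.ReflTransGen (fun p q => 0 < w p q) i j) :
    ∃ c > 0, ∀ f : ι → Fin 2 → ℝ, (∀ k, ∑ i, γ i * f i k = 0) →
      c * ‖f‖ ^ 4 ≤ ∑ k, ∑ i, ∑ j, γ i * w i j *
        (enorm2 (f j) * f j k - enorm2 (f i) * f i k) ^ 2 := by
  refine exists_pos_mul_norm_pow_le (K := {f : ι → Fin 2 → ℝ | ∀ k, ∑ i, γ i * f i k = 0})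
    ?_ ?_ ?_ (by norm_num) ?_ ?_ ?_
  · simp only [Set.ofPred_forall]
    exact isClosed_iInter fun k => isClosed_eq (by fun_prop) continuous_const
  · intro r f hf k
    have := hf k
    simp only [Pi.smul_apply, smul_eq_mul, mul_left_comm _ r, ← mul_sum, this, mul_zero]
  · have (i : ι) : Continuous fun f : ι → Fin 2 → ℝ => enorm2 (f i) :=
      continuous_enorm2.comp (continuous_apply i)
    fun_prop
  · intro r hr f
    simp only [Pi.smul_apply, smul_eq_mul, enorm2_smul, abs_of_pos hr, mul_sum]
    refine sum_congr rfl fun k _ => sum_congr rfl fun i _ => sum_congr rfl fun j _ => ?_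
    ring
  · simp
  · intro f hf hf0
    have hnn (k : Fin 2) (i j : ι) : 0 ≤ γ i * w i j *
        (enorm2 (f j) * f j k - enorm2 (f i) * f i k) ^ 2 :=
      mul_nonneg (mul_nonneg (hpos i).le (hw i j)) (sq_nonneg _)
    have hnn' (k : Fin 2) := sum_nonneg fun i (_ : i ∈ univ) =>
      sum_nonneg fun j (_ : j ∈ univ) => hnn k i j
    refine lt_of_le_of_ne (sum_nonneg fun k _ => hnn' k) fun h => hf0 ?_
    rw [eq_comm, sum_eq_zero_iff_of_nonneg fun k _ => hnn' k] at h
    have hconst (k : Fin 2) (i j : ι) : enorm2 (f i) * f i k = enorm2 (f j) * f j k :=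
      eq_of_dirichlet_eq_zero (u := fun i => enorm2 (f i) * f i k) hw hpos hsc (h k (mem_univ k)) i j
    funext p
    have hcube : ∑ i, γ i * enorm2 (f i) ^ 3 = 0 := by
      have h1 (i : ι) : γ i * enorm2 (f i) ^ 3 = enorm2 (f p) * f p 0 * (γ i * f i 0)
          + enorm2 (f p) * f p 1 * (γ i * f i 1) := by
        rw [hconst 0 p i, hconst 1 p i, pow_succ', enorm2_sq]
        ring
      simp only [h1, sum_add_distrib, ← mul_sum, hf 0, hf 1, mul_zero, add_zero]
    rw [sum_eq_zero_iff_of_nonneg fun i _ =>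
      mul_nonneg (hpos i).le (pow_nonneg (enorm2_nonneg _) 3)] at hcube
    have hp : enorm2 (f p) = 0 := by simpa [(hpos p).ne'] using hcube p (mem_univ p)
    funext k
    simpa [hp] using abs_apply_le_enorm2 (f p) k

end Coercivity

section Lyapunov

open Finset Real

/-- The component of `v` along the heading `ϑ`. -/
noncomputable def along (v : Fin 2 → ℝ) (ϑ : ℝ) : ℝ := v 0 * cos ϑ + v 1 * sin ϑ

/-- The component of `v` orthogonal to the heading `ϑ`. -/
noncomputable def across (v : Fin 2 → ℝ) (ϑ : ℝ) : ℝ := v 1 * cos ϑ - v 0 * sin ϑ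

/-- The velocity of a unicycle with heading `ϑ` and consensus vector `v`. -/
noncomputable def velocity (v : Fin 2 → ℝ) (ϑ : ℝ) : Fin 2 → ℝ :=
  (enorm2 v * along v ϑ) • ![cos ϑ, sin ϑ]

/-- The deviation of the velocity from `‖v‖ • v`. -/
noncomputable def defect (v : Fin 2 → ℝ) (ϑ : ℝ) : Fin 2 → ℝ :=
  (enorm2 v * across v ϑ) • ![-sin ϑ, cos ϑ]

theorem along_sq_add_across_sq (v : Fin 2 → ℝ) (ϑ : ℝ) :
    along v ϑ ^ 2 + across v ϑ ^ 2 = enorm2 v ^ 2 := by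
  rw [enorm2_sq, along, across]
  linear_combination (v 0 ^ 2 + v 1 ^ 2) * sin_sq_add_cos_sq ϑ

theorem abs_along_le (v : Fin 2 → ℝ) (ϑ : ℝ) : |along v ϑ| ≤ enorm2 v :=
  abs_le_of_sq_le_sq (by nlinarith [along_sq_add_across_sq v ϑ, sq_nonneg (across v ϑ)])
    (enorm2_nonneg v)

theorem velocity_add_defect (v : Fin 2 → ℝ) (ϑ : ℝ) (k : Fin 2) :
    velocity v ϑ k = enorm2 v * v k - defect v ϑ k := by
  have h := sin_sq_add_cos_sq ϑ
  fin_cases k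
  · simp [velocity, defect, along, across]
    linear_combination (enorm2 v * v 0) * h
  · simp [velocity, defect, along, across]
    linear_combination (enorm2 v * v 1) * h

theorem defect_sq (v : Fin 2 → ℝ) (ϑ : ℝ) :
    defect v ϑ 0 ^ 2 + defect v ϑ 1 ^ 2 = enorm2 v ^ 2 * across v ϑ ^ 2 := by
  simp [defect]
  linear_combination (enorm2 v ^ 2 * across v ϑ ^ 2) * sin_sq_add_cos_sq ϑ

theorem abs_velocity_le (v : Fin 2 → ℝ) (ϑ : ℝ) (k : Fin 2) :
    |velocity v ϑ k| ≤ enorm2 v ^ 2 := by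
  have h : |(![cos ϑ, sin ϑ] : Fin 2 → ℝ) k| ≤ 1 := by
    fin_cases k
    · exact abs_cos_le_one ϑ
    · exact abs_sin_le_one ϑ
  rw [velocity, Pi.smul_apply, smul_eq_mul, abs_mul, abs_mul, abs_of_nonneg (enorm2_nonneg v)]
  have h1 := abs_along_le v ϑ
  have h2 := enorm2_nonneg v
  calc enorm2 v * |along v ϑ| * |(![cos ϑ, sin ϑ] : Fin 2 → ℝ) k|
      ≤ enorm2 v * enorm2 v * 1 := by gcongr
    _ = enorm2 v ^ 2 := by ring

variable {ι : Type*} [Fintype ι]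

/-- The negative weighted Laplacian of a planar field. -/
noncomputable def consensus (w : ι → ι → ℝ) (y : ι → Fin 2 → ℝ) (i : ι) (k : Fin 2) : ℝ :=
  ∑ j, w i j * (y j k - y i k)

/-- The Lyapunov function, in terms of the consensus field `f` and the headings. -/
noncomputable def lyapunov (γ : ι → ℝ) (β : ℝ) (f : ι → Fin 2 → ℝ) (θ : ι → ℝ) : ℝ :=
  ∑ i, (γ i / 3 * enorm2 (f i) ^ 3 + β * (enorm2 (f i) ^ 2 * along (f i) (θ i)))

/-- The derivative of `lyapunov` when `f` has velocity `g` and the headings turn at the rate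
`-k * across (f i) (θ i)`. -/
noncomputable def lyapunovDeriv (γ : ι → ℝ) (β k : ℝ) (f g : ι → Fin 2 → ℝ) (θ : ι → ℝ) : ℝ :=
  ∑ i, (γ i * (enorm2 (f i) * (f i 0 * g i 0 + f i 1 * g i 1)) +
    β * (2 * (f i 0 * g i 0 + f i 1 * g i 1) * along (f i) (θ i)
      + enorm2 (f i) ^ 2 * (along (g i) (θ i) - k * across (f i) (θ i) ^ 2)))

variable {w : ι → ι → ℝ} {γ : ι → ℝ}

theorem norm_pow_three_le_sum_enorm2 (f : ι → Fin 2 → ℝ) : ‖f‖ ^ 3 ≤ ∑ i, enorm2 (f i) ^ 3 := by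
  have hnn (i : ι) : 0 ≤ enorm2 (f i) ^ 3 := pow_nonneg (enorm2_nonneg _) 3
  rcases isEmpty_or_nonempty ι with h | h
  · simp [Subsingleton.elim f 0]
  obtain ⟨i, hi⟩ := Finite.exists_max fun i => enorm2 (f i)
  have hle : ‖f‖ ≤ enorm2 (f i) := by
    refine (pi_norm_le_iff_of_nonneg (enorm2_nonneg _)).mpr fun j =>
      (pi_norm_le_iff_of_nonneg (enorm2_nonneg _)).mpr fun k => ?_
    exact (abs_apply_le_enorm2 (f j) k).trans (hi j)
  calc ‖f‖ ^ 3 ≤ enorm2 (f i) ^ 3 := by gcongr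
    _ ≤ ∑ i, enorm2 (f i) ^ 3 := single_le_sum (fun i _ => hnn i) (mem_univ i)

theorem enorm2_apply_le (f : ι → Fin 2 → ℝ) (i : ι) : enorm2 (f i) ≤ 2 * ‖f‖ :=
  (enorm2_le_two_mul_norm (f i)).trans (by gcongr; exact norm_le_pi_norm f i)

theorem abs_apply_apply_le (f : ι → Fin 2 → ℝ) (i : ι) (k : Fin 2) : |f i k| ≤ ‖f‖ :=
  (norm_le_pi_norm (f i) k).trans (norm_le_pi_norm f i)

theorem mul_norm_pow_le_lyapunov {β m : ℝ} (hm : 0 < m) (hγ : ∀ i, m ≤ γ i) (hβ0 : 0 ≤ β)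
    (hβ : β ≤ m / 6) (f : ι → Fin 2 → ℝ) (θ : ι → ℝ) :
    m / 6 * ‖f‖ ^ 3 ≤ lyapunov γ β f θ := by
  calc m / 6 * ‖f‖ ^ 3 ≤ m / 6 * ∑ i, enorm2 (f i) ^ 3 := by
        gcongr
        exact norm_pow_three_le_sum_enorm2 f
    _ ≤ lyapunov γ β f θ := by
        rw [lyapunov, mul_sum]
        refine sum_le_sum fun i _ => ?_
        have h1 := (abs_le.mp (abs_along_le (f i) (θ i))).1
        have h2 := enorm2_nonneg (f i)
        have h3 : 0 ≤ β * enorm2 (f i) ^ 2 * (along (f i) (θ i) + enorm2 (f i)) := by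
          have : 0 ≤ along (f i) (θ i) + enorm2 (f i) := by linarith
          positivity
        have h4 : (m / 3) * enorm2 (f i) ^ 3 ≤ γ i / 3 * enorm2 (f i) ^ 3 := by
          gcongr
          exact hγ i
        have h5 : β * enorm2 (f i) ^ 3 ≤ m / 6 * enorm2 (f i) ^ 3 := by gcongr
        nlinarith

theorem lyapunov_le_mul_norm_pow {β : ℝ} (hγ : ∀ i, 0 < γ i) (hβ0 : 0 ≤ β)
    (f : ι → Fin 2 → ℝ) (θ : ι → ℝ) :
    lyapunov γ β f θ ≤ (∑ i, (γ i / 3 + β) * 8) * ‖f‖ ^ 3 := by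
  rw [lyapunov, sum_mul]
  refine sum_le_sum fun i _ => ?_
  have h1 := (abs_le.mp (abs_along_le (f i) (θ i))).2
  have h2 := enorm2_nonneg (f i)
  have h3 : enorm2 (f i) ^ 3 ≤ 8 * ‖f‖ ^ 3 := by
    calc enorm2 (f i) ^ 3 ≤ (2 * ‖f‖) ^ 3 := by gcongr; exact enorm2_apply_le f i
      _ = 8 * ‖f‖ ^ 3 := by ring
  have h4 : enorm2 (f i) ^ 2 * along (f i) (θ i) ≤ 8 * ‖f‖ ^ 3 := by
    refine le_trans ?_ h3
    calc enorm2 (f i) ^ 2 * along (f i) (θ i) ≤ enorm2 (f i) ^ 2 * enorm2 (f i) := by gcongr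
      _ = enorm2 (f i) ^ 3 := by ring
  have h5 := (hγ i).le
  calc _ ≤ γ i / 3 * (8 * ‖f‖ ^ 3) + β * (8 * ‖f‖ ^ 3) := by gcongr
    _ = _ := by ring

theorem abs_consensus_velocity_le (hw : ∀ i j, 0 ≤ w i j) (f : ι → Fin 2 → ℝ) (θ : ι → ℝ)
    (i : ι) (k : Fin 2) :
    |consensus w (fun i => velocity (f i) (θ i)) i k| ≤ 8 * (∑ i, ∑ j, w i j) * ‖f‖ ^ 2 := by
  have hv (j : ι) : |velocity (f j) (θ j) k| ≤ 4 * ‖f‖ ^ 2 := by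
    refine (abs_velocity_le _ _ _).trans ?_
    calc enorm2 (f j) ^ 2 ≤ (2 * ‖f‖) ^ 2 := by
          gcongr
          · exact enorm2_nonneg _
          · exact enorm2_apply_le f j
      _ = 4 * ‖f‖ ^ 2 := by ring
  calc |consensus w (fun i => velocity (f i) (θ i)) i k|
      ≤ ∑ j, |w i j * (velocity (f j) (θ j) k - velocity (f i) (θ i) k)| :=
        abs_sum_le_sum_abs _ _
    _ ≤ ∑ j, w i j * (8 * ‖f‖ ^ 2) := by
        refine sum_le_sum fun j _ => ?_
        rw [abs_mul, abs_of_nonneg (hw i j)]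
        refine mul_le_mul_of_nonneg_left ?_ (hw i j)
        linarith [abs_sub (velocity (f j) (θ j) k) (velocity (f i) (θ i) k), hv i, hv j]
    _ = (∑ j, w i j) * (8 * ‖f‖ ^ 2) := by rw [sum_mul]
    _ ≤ (∑ i, ∑ j, w i j) * (8 * ‖f‖ ^ 2) := by
        refine mul_le_mul_of_nonneg_right ?_ (by positivity)
        exact single_le_sum (f := fun i => ∑ j, w i j)
          (fun i _ => sum_nonneg fun j _ => hw i j) (mem_univ i)
    _ = _ := by ring

/-- The alignment term of the Lyapunov derivative. -/
theorem sum_alignment_le (hw : ∀ i j, 0 ≤ w i j) (k : ℝ) (f : ι → Fin 2 → ℝ) (θ : ι → ℝ)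
    {g : ι → Fin 2 → ℝ} (hg : g = consensus w fun i => velocity (f i) (θ i)) :
    ∑ i, (2 * (f i 0 * g i 0 + f i 1 * g i 1) * along (f i) (θ i)
      + enorm2 (f i) ^ 2 * (along (g i) (θ i) - k * across (f i) (θ i) ^ 2)) ≤
    Fintype.card ι * (128 * ∑ i, ∑ j, w i j) * ‖f‖ ^ 4
      - k * ∑ i, enorm2 (f i) ^ 2 * across (f i) (θ i) ^ 2 := by
  have hW : 0 ≤ ∑ i, ∑ j, w i j := sum_nonneg fun i _ => sum_nonneg fun j _ => hw i j
  set W := ∑ i, ∑ j, w i j with hWdef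
  have hN : 0 ≤ ‖f‖ := norm_nonneg f
  have key (i : ι) : 2 * (f i 0 * g i 0 + f i 1 * g i 1) * along (f i) (θ i)
      + enorm2 (f i) ^ 2 * (along (g i) (θ i) - k * across (f i) (θ i) ^ 2) ≤
      128 * W * ‖f‖ ^ 4 - k * (enorm2 (f i) ^ 2 * across (f i) (θ i) ^ 2) := by
    have hgk (l : Fin 2) : |g i l| ≤ 8 * W * ‖f‖ ^ 2 := by
      rw [hg]
      exact abs_consensus_velocity_le hw f θ i l
    have hr := enorm2_apply_le f i
    have hr0 := enorm2_nonneg (f i)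
    have h1 : |f i 0 * g i 0 + f i 1 * g i 1| ≤ 16 * W * ‖f‖ ^ 3 := by
      calc |f i 0 * g i 0 + f i 1 * g i 1| ≤ |f i 0| * |g i 0| + |f i 1| * |g i 1| := by
            rw [← abs_mul, ← abs_mul]
            exact abs_add_le _ _
        _ ≤ ‖f‖ * (8 * W * ‖f‖ ^ 2) + ‖f‖ * (8 * W * ‖f‖ ^ 2) := by
            gcongr
            · exact abs_apply_apply_le f i 0
            · exact hgk 0
            · exact abs_apply_apply_le f i 1
            · exact hgk 1
        _ = _ := by ring
    have h2 : 2 * (f i 0 * g i 0 + f i 1 * g i 1) * along (f i) (θ i) ≤ 64 * W * ‖f‖ ^ 4 := by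
      calc _ ≤ |2 * (f i 0 * g i 0 + f i 1 * g i 1) * along (f i) (θ i)| := le_abs_self _
        _ = 2 * |f i 0 * g i 0 + f i 1 * g i 1| * |along (f i) (θ i)| := by
            rw [abs_mul, abs_mul, abs_two]
        _ ≤ 2 * (16 * W * ‖f‖ ^ 3) * (2 * ‖f‖) := by
            gcongr
            exact (abs_along_le _ _).trans hr
        _ = _ := by ring
    have h3 : along (g i) (θ i) ≤ 16 * W * ‖f‖ ^ 2 := by
      calc along (g i) (θ i) ≤ |g i 0 * cos (θ i)| + |g i 1 * sin (θ i)| :=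
            add_le_add (le_abs_self _) (le_abs_self _)
        _ ≤ |g i 0| * 1 + |g i 1| * 1 := by
            rw [abs_mul, abs_mul]
            gcongr
            · exact abs_cos_le_one _
            · exact abs_sin_le_one _
        _ ≤ _ := by linarith [hgk 0, hgk 1]
    have h4 : enorm2 (f i) ^ 2 * along (g i) (θ i) ≤ 64 * W * ‖f‖ ^ 4 := by
      calc _ ≤ enorm2 (f i) ^ 2 * (16 * W * ‖f‖ ^ 2) := by gcongr
        _ ≤ (2 * ‖f‖) ^ 2 * (16 * W * ‖f‖ ^ 2) := by gcongr
        _ = _ := by ring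
    linarith
  calc _ ≤ ∑ i : ι, (128 * W * ‖f‖ ^ 4 - k * (enorm2 (f i) ^ 2 * across (f i) (θ i) ^ 2)) :=
        sum_le_sum fun i _ => key i
    _ = _ := by
        simp only [sum_sub_distrib, sum_const, card_univ, nsmul_eq_mul, ← mul_sum]
        ring

/-- The consensus term of the Lyapunov derivative. -/
theorem sum_consensus_le (hw : ∀ i j, 0 ≤ w i j) (hpos : ∀ i, 0 < γ i)
    (hγ : ∀ j, ∑ i, γ i * w i j = γ j * ∑ i, w j i) {η : ℝ} (hη : 0 < η)
    (f : ι → Fin 2 → ℝ) (θ : ι → ℝ)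
    {g : ι → Fin 2 → ℝ} (hg : g = consensus w fun i => velocity (f i) (θ i)) :
    ∑ i, γ i * (enorm2 (f i) * (f i 0 * g i 0 + f i 1 * g i 1)) ≤
      -(1 / 2) * (∑ k, ∑ i, ∑ j, γ i * w i j *
        (enorm2 (f j) * f j k - enorm2 (f i) * f i k) ^ 2)
      + (∑ i, ∑ j, γ i * w i j) * (8 * η * ‖f‖ ^ 4
        + 2 / η * ∑ i, enorm2 (f i) ^ 2 * across (f i) (θ i) ^ 2) := by
  set S := ∑ i, enorm2 (f i) ^ 2 * across (f i) (θ i) ^ 2 with hS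
  set G : ι → Fin 2 → ℝ := fun i k => enorm2 (f i) * f i k with hG
  set e : ι → Fin 2 → ℝ := fun i => defect (f i) (θ i) with he
  have hsplit : ∑ i, γ i * (enorm2 (f i) * (f i 0 * g i 0 + f i 1 * g i 1)) =
      ∑ k, (∑ i, ∑ j, γ i * w i j * (G i k * (G j k - G i k)))
      + ∑ i, ∑ j, γ i * w i j * (G i 0 * (e i 0 - e j 0) + G i 1 * (e i 1 - e j 1)) := by
    rw [Fin.sum_univ_two]
    simp only [← sum_add_distrib]
    refine sum_congr rfl fun i _ => ?_
    simp only [hg, consensus, mul_sum, velocity_add_defect, ← sum_add_distrib]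
    refine sum_congr rfl fun j _ => ?_
    simp only [hG, he]
    ring
  have heS (i : ι) : e i 0 ^ 2 + e i 1 ^ 2 ≤ S := by
    rw [he, defect_sq]
    exact single_le_sum (f := fun i => enorm2 (f i) ^ 2 * across (f i) (θ i) ^ 2)
      (fun i _ => by positivity) (mem_univ i)
  have hGN (i : ι) : G i 0 ^ 2 + G i 1 ^ 2 ≤ 16 * ‖f‖ ^ 4 := by
    calc G i 0 ^ 2 + G i 1 ^ 2 = enorm2 (f i) ^ 4 := by
          simp only [hG]
          linear_combination (-enorm2 (f i) ^ 2) * enorm2_sq (f i)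
      _ ≤ (2 * ‖f‖) ^ 4 := by
          gcongr
          · exact enorm2_nonneg _
          · exact enorm2_apply_le f i
      _ = _ := by ring
  have hyoung (x y : ℝ) : x * y ≤ η / 2 * x ^ 2 + 1 / (2 * η) * y ^ 2 := by
    have : 0 ≤ (η * x - y) ^ 2 / (2 * η) := by positivity
    have h' : (η * x - y) ^ 2 / (2 * η) = η / 2 * x ^ 2 + 1 / (2 * η) * y ^ 2 - x * y := by
      field_simp
      ring
    linarith
  have hcross (i j : ι) : G i 0 * (e i 0 - e j 0) + G i 1 * (e i 1 - e j 1) ≤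
      8 * η * ‖f‖ ^ 4 + 2 / η * S := by
    have h1 := hyoung (G i 0) (e i 0 - e j 0)
    have h2 := hyoung (G i 1) (e i 1 - e j 1)
    have h3 : (e i 0 - e j 0) ^ 2 + (e i 1 - e j 1) ^ 2 ≤ 4 * S := by
      nlinarith [heS i, heS j, sq_nonneg (e i 0 + e j 0), sq_nonneg (e i 1 + e j 1)]
    have h4 : η / 2 * (G i 0 ^ 2 + G i 1 ^ 2) ≤ η / 2 * (16 * ‖f‖ ^ 4) := by
      gcongr
      exact hGN i
    have h5 : 1 / (2 * η) * ((e i 0 - e j 0) ^ 2 + (e i 1 - e j 1) ^ 2) ≤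
        1 / (2 * η) * (4 * S) := by gcongr
    have h6 : 1 / (2 * η) * (4 * S) = 2 / η * S := by
      field_simp
      ring
    linarith
  rw [hsplit, mul_sum]
  refine add_le_add (sum_le_sum fun k _ => ?_) ?_
  · exact (sum_mul_laplacian_eq_neg_dirichlet hγ fun i => G i k).le
  · simp only [sum_mul]
    refine sum_le_sum fun i _ => sum_le_sum fun j _ => ?_
    exact mul_le_mul_of_nonneg_left (hcross i j) (mul_nonneg (hpos i).le (hw i j))

/-- For a large gain the Lyapunov function is equivalent to the cube of the norm of the consensus
field and decreases strictly along solutions. -/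
theorem exists_lyapunov_consts (hw : ∀ i j, 0 ≤ w i j)
    (hsc : ∀ i j, Relation.ReflTransGen (fun p q => 0 < w p q) i j) (hpos : ∀ i, 0 < γ i)
    (hγ : ∀ j, ∑ i, γ i * w i j = γ j * ∑ i, w j i) :
    ∃ β b B κ ks : ℝ, 0 < b ∧ 0 < B ∧ 0 < κ ∧ 0 < ks ∧
      (∀ f θ, b * ‖f‖ ^ 3 ≤ lyapunov γ β f θ) ∧ (∀ f θ, lyapunov γ β f θ ≤ B * ‖f‖ ^ 3) ∧
      ∀ k, ks < k → ∀ (f : ι → Fin 2 → ℝ) (θ : ι → ℝ), (∀ l, ∑ i, γ i * f i l = 0) →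
        lyapunovDeriv γ β k f (consensus w fun i => velocity (f i) (θ i)) θ ≤ -κ * ‖f‖ ^ 4 := by
  obtain ⟨m, hm, hmγ⟩ : ∃ m > 0, ∀ i, m ≤ γ i := by
    rcases isEmpty_or_nonempty ι with h | h
    · exact ⟨1, one_pos, fun i => h.elim i⟩
    · obtain ⟨i, hi⟩ := Finite.exists_min γ
      exact ⟨γ i, hpos i, hi⟩
  obtain ⟨c, hc, hcoer⟩ := exists_coercivity_const hw hpos hsc
  have hA : 0 ≤ ∑ i, ∑ j, γ i * w i j :=
    sum_nonneg fun i _ => sum_nonneg fun j _ => mul_nonneg (hpos i).le (hw i j)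
  have hQ : 0 ≤ Fintype.card ι * (128 * ∑ i, ∑ j, w i j) :=
    mul_nonneg (Nat.cast_nonneg _)
      (mul_nonneg (by norm_num) (sum_nonneg fun i _ => sum_nonneg fun j _ => hw i j))
  set A := ∑ i, ∑ j, γ i * w i j
  set Q := Fintype.card ι * (128 * ∑ i, ∑ j, w i j) with hQdef
  set η := c / (32 * (A + 1)) with hη
  have hη0 : 0 < η := by positivity
  have hηA : A * (8 * η) ≤ c / 4 := by
    have : A * (8 * η) = c / 4 * (A / (A + 1)) := by
      rw [hη]
      field_simp
      ring
    rw [this]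
    exact mul_le_of_le_one_right (by positivity) ((div_le_one (by positivity)).mpr (by linarith))
  set β := min (m / 6) (c / (8 * (Q + 1))) with hβ
  have hβ0 : 0 < β := lt_min (by positivity) (by positivity)
  have hβQ : β * Q ≤ c / 8 := by
    calc β * Q ≤ c / (8 * (Q + 1)) * Q := by
          gcongr
          exact min_le_right _ _
      _ = c / 8 * (Q / (Q + 1)) := by field_simp
      _ ≤ c / 8 :=
        mul_le_of_le_one_right (by positivity) ((div_le_one (by positivity)).mpr (by linarith))
  have hBn : 0 ≤ ∑ i, (γ i / 3 + β) * 8 := sum_nonneg fun i _ => by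
    have := hpos i
    positivity
  refine ⟨β, m / 6, (∑ i, (γ i / 3 + β) * 8) + 1, c / 8, (A * (2 / η) + 1) / β,
    by positivity, by positivity, by positivity, by positivity,
    mul_norm_pow_le_lyapunov hm hmγ hβ0.le (min_le_left _ _), fun f θ => ?_, fun k hk f θ hf => ?_⟩
  · refine (lyapunov_le_mul_norm_pow hpos hβ0.le f θ).trans ?_
    gcongr
    linarith
  · have h1 := sum_consensus_le hw hpos hγ hη0 f θ rfl
    have h2 := sum_alignment_le hw k f θ rfl
    have h3 := hcoer f hf
    rw [← hQdef] at h2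
    set S := ∑ i, enorm2 (f i) ^ 2 * across (f i) (θ i) ^ 2 with hS
    have hS0 : 0 ≤ S := sum_nonneg fun i _ => by positivity
    rw [lyapunovDeriv, sum_add_distrib, ← mul_sum]
    have h4 := mul_le_mul_of_nonneg_left h2 hβ0.le
    have h5 : A * (2 / η) + 1 ≤ β * k := by
      rw [div_lt_iff₀ hβ0] at hk
      linarith
    have h6 : (A * (2 / η) + 1) * S ≤ β * k * S := by gcongr
    have h7 : A * (8 * η) * ‖f‖ ^ 4 ≤ c / 4 * ‖f‖ ^ 4 := by gcongr
    have h8 : β * Q * ‖f‖ ^ 4 ≤ c / 8 * ‖f‖ ^ 4 := by gcongr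
    nlinarith

end Lyapunov

section Consensus

open Finset

variable {ι : Type*} [Fintype ι] {w : ι → ι → ℝ} {γ : ι → ℝ}

theorem consensus_smul (r : ℝ) (x : ι → Fin 2 → ℝ) : consensus w (r • x) = r • consensus w x := by
  ext i k
  simp only [consensus, Pi.smul_apply, smul_eq_mul, mul_sum]
  exact sum_congr rfl fun j _ => by ring

theorem continuous_consensus : Continuous (consensus w) := by
  unfold consensus
  fun_prop

theorem sum_mul_consensus_eq_zero (hγ : ∀ j, ∑ i, γ i * w i j = γ j * ∑ i, w j i)
    (x : ι → Fin 2 → ℝ) (k : Fin 2) : ∑ i, γ i * consensus w x i k = 0 := by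
  have h1 : ∑ i, γ i * consensus w x i k =
      ∑ j, (∑ i, γ i * w i j) * x j k - ∑ i, (γ i * ∑ j, w i j) * x i k := by
    simp only [consensus, mul_sum, sum_mul, mul_sub, sum_sub_distrib, mul_assoc]
    rw [sum_comm]
  rw [h1]
  simp [hγ]

theorem eq_of_consensus_eq_zero (hw : ∀ i j, 0 ≤ w i j)
    (hsc : ∀ i j, Relation.ReflTransGen (fun p q => 0 < w p q) i j) (hpos : ∀ i, 0 < γ i)
    (hγ : ∀ j, ∑ i, γ i * w i j = γ j * ∑ i, w j i)
    {x : ι → Fin 2 → ℝ} (hx : consensus w x = 0) (i j : ι) : x i = x j := by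
  ext k
  refine eq_of_dirichlet_eq_zero (u := fun i => x i k) hw hpos hsc ?_ i j
  have h1 := sum_mul_laplacian_eq_neg_dirichlet hγ fun i => x i k
  have h2 : ∑ i, ∑ j, γ i * w i j * (x i k * (x j k - x i k)) = 0 := by
    refine sum_eq_zero fun i _ => ?_
    have h3 : ∑ j, γ i * w i j * (x i k * (x j k - x i k)) = γ i * x i k * consensus w x i k := by
      rw [consensus, mul_sum]
      exact sum_congr rfl fun j _ => by ring
    rw [h3, hx]
    simp
  linarith

/-- On a strongly connected graph the consensus field controls all relative positions. -/
theorem exists_abs_sub_le_mul_norm_consensus (hw : ∀ i j, 0 ≤ w i j)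
    (hsc : ∀ i j, Relation.ReflTransGen (fun p q => 0 < w p q) i j) (hpos : ∀ i, 0 < γ i)
    (hγ : ∀ j, ∑ i, γ i * w i j = γ j * ∑ i, w j i) :
    ∃ C > 0, ∀ (x : ι → Fin 2 → ℝ) (i j : ι) (k : Fin 2),
      |x i k - x j k| ≤ C * ‖consensus w x‖ := by
  rcases isEmpty_or_nonempty ι with h | ⟨⟨p⟩⟩
  · exact ⟨1, one_pos, fun x i => h.elim i⟩
  obtain ⟨c, hc, hle⟩ := exists_pos_mul_norm_pow_le (K := {x : ι → Fin 2 → ℝ | x p = 0})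
    (F := fun x => ‖consensus w x‖) (d := 1)
    (isClosed_eq (continuous_apply p) continuous_const)
    (fun r x hx => by
      change r • x p = 0
      rw [show x p = 0 from hx, smul_zero])
    continuous_consensus.norm one_ne_zero
    (fun r hr x => by rw [consensus_smul, norm_smul, Real.norm_of_nonneg hr.le, pow_one])
    (norm_nonneg _)
    (fun x hx hx0 => norm_pos_iff.mpr fun h0 => hx0 (by
      funext i
      rw [eq_of_consensus_eq_zero hw hsc hpos hγ h0 i p]
      exact hx))
  refine ⟨2 / c, by positivity, fun x i j k => ?_⟩
  have h1 := hle (fun i => x i - x p) (sub_self _)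
  have h2 : consensus w (fun i => x i - x p) = consensus w x := by
    ext i k
    simp [consensus]
  simp only [pow_one, h2] at h1
  have h3 := abs_apply_apply_le (fun i => x i - x p) i k
  have h4 := abs_apply_apply_le (fun i => x i - x p) j k
  have h5 : |x i k - x j k| ≤ 2 * ‖fun i => x i - x p‖ := by
    have h6 := abs_sub ((fun i => x i - x p) i k) ((fun i => x i - x p) j k)
    simp only [Pi.sub_apply, sub_sub_sub_cancel_right] at h6 h3 h4
    linarith
  rw [div_mul_eq_mul_div, le_div_iff₀ hc]
  nlinarith

theorem Dmax_nonneg {n : ℕ} (x : Fin n → Fin 2 → ℝ) : 0 ≤ Dmax x :=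
  Real.iSup_nonneg fun _ => Real.iSup_nonneg fun _ => enorm2_nonneg _

theorem enorm2_sub_le_Dmax {n : ℕ} (x : Fin n → Fin 2 → ℝ) (i j : Fin n) :
    enorm2 (x i - x j) ≤ Dmax x :=
  (le_ciSup (f := fun j => enorm2 (x i - x j)) (Set.finite_range _).bddAbove j).trans
    (le_ciSup (f := fun i => ⨆ j, enorm2 (x i - x j)) (Set.finite_range _).bddAbove i)

theorem Dmax_le {n : ℕ} {x : Fin n → Fin 2 → ℝ} {M : ℝ} (hM : 0 ≤ M)
    (h : ∀ i j k, |x i k - x j k| ≤ M) : Dmax x ≤ 2 * M :=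
  Real.iSup_le (fun i => Real.iSup_le (fun j => (enorm2_le_two_mul_norm _).trans <| by
    gcongr
    exact (pi_norm_le_iff_of_nonneg hM).mpr (h i j)) (by positivity)) (by positivity)

theorem norm_consensus_le_mul_Dmax {n : ℕ} {w : Fin n → Fin n → ℝ} (hw : ∀ i j, 0 ≤ w i j)
    (x : Fin n → Fin 2 → ℝ) : ‖consensus w x‖ ≤ (∑ i, ∑ j, w i j) * Dmax x := by
  have hnn : 0 ≤ (∑ i, ∑ j, w i j) * Dmax x :=
    mul_nonneg (sum_nonneg fun i _ => sum_nonneg fun j _ => hw i j) (Dmax_nonneg x)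
  refine (pi_norm_le_iff_of_nonneg hnn).mpr fun i => (pi_norm_le_iff_of_nonneg hnn).mpr fun k => ?_
  calc ‖consensus w x i k‖ ≤ ∑ j, |w i j * (x j k - x i k)| := abs_sum_le_sum_abs _ _
    _ ≤ ∑ j, w i j * Dmax x := by
        refine sum_le_sum fun j _ => ?_
        rw [abs_mul, abs_of_nonneg (hw i j)]
        exact mul_le_mul_of_nonneg_left
          ((abs_apply_le_enorm2 (x j - x i) k).trans (enorm2_sub_le_Dmax x j i)) (hw i j)
    _ = (∑ j, w i j) * Dmax x := by rw [sum_mul]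
    _ ≤ _ := by
        refine mul_le_mul_of_nonneg_right ?_ (Dmax_nonneg x)
        exact single_le_sum (f := fun i => ∑ j, w i j)
          (fun i _ => sum_nonneg fun j _ => hw i j) (mem_univ i)

end Consensus

section Decay

open Set Filter Topology

/-- A differentiable function on `[0, T)` with nonpositive derivative stays below its value
at `0`. -/
theorem le_initial_of_hasDerivWithinAt_nonpos {U U' : ℝ → ℝ} {t : ℝ} (ht : 0 ≤ t)
    (hU : ∀ s ∈ Icc 0 t, HasDerivWithinAt U (U' s) (Ici 0) s) (hU' : ∀ s ∈ Icc 0 t, U' s ≤ 0) :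
    U t ≤ U 0 := by
  have hanti : AntitoneOn U (Icc 0 t) :=
    antitoneOn_of_hasDerivWithinAt_nonpos (convex_Icc 0 t)
      (fun s hs => (hU s hs).continuousWithinAt.mono fun r hr => hr.1)
      (fun s hs => (hU s (interior_subset hs)).mono fun r hr => (interior_subset hr).1)
      (fun s hs => hU' s (interior_subset hs))
  exact hanti ⟨le_rfl, ht⟩ ⟨ht, le_rfl⟩ ht

/-- Decay to zero from a Lyapunov function of cubic growth with quartic dissipation. -/
theorem tendsto_zero_of_cubic_lyapunov {U U' N : ℝ → ℝ} {b B κ : ℝ} (hb : 0 < b) (hB : 0 < B)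
    (hκ : 0 < κ) (hN : ∀ t, 0 ≤ N t) (hlow : ∀ t, b * N t ^ 3 ≤ U t)
    (hupp : ∀ t, U t ≤ B * N t ^ 3) (hU : ∀ t, 0 ≤ t → HasDerivWithinAt U (U' t) (Ici 0) t)
    (hU' : ∀ t, 0 ≤ t → U' t ≤ -κ * N t ^ 4) : Tendsto N atTop (𝓝 0) := by
  have hanti : AntitoneOn U (Ici 0) :=
    antitoneOn_of_hasDerivWithinAt_nonpos (convex_Ici 0)
      (fun s hs => (hU s hs).continuousWithinAt)
      (fun s hs => (hU s (interior_subset hs)).mono interior_subset)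
      (fun s hs => (hU' s (interior_subset hs)).trans (by
        have := pow_nonneg (hN s) 4
        nlinarith))
  rw [Metric.tendsto_atTop]
  intro ε hε
  obtain ⟨τ, hτ, hUτ⟩ : ∃ τ, 0 ≤ τ ∧ U τ < b * ε ^ 3 := by
    by_contra! hcon
    have he : 0 < b * ε ^ 3 := by positivity
    set m := min 1 (b * ε ^ 3 / B) with hm
    have hm0 : 0 < m := lt_min one_pos (by positivity)
    have hmN (t : ℝ) (ht : 0 ≤ t) : m ≤ N t := by
      by_contra! hlt
      have h1 : N t ^ 3 ≤ N t := by
        have h2 : N t ≤ 1 := hlt.le.trans (min_le_left _ _)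
        simpa using pow_le_pow_of_le_one (hN t) h2 (show 1 ≤ 3 by norm_num)
      have h3 : N t ^ 3 < b * ε ^ 3 / B := h1.trans_lt (hlt.trans_le (min_le_right _ _))
      rw [lt_div_iff₀ hB] at h3
      linarith [hcon t ht, hupp t]
    have hlin (t : ℝ) (ht : 0 ≤ t) : U t + κ * m ^ 4 * t ≤ U 0 := by
      have := le_initial_of_hasDerivWithinAt_nonpos (U := fun t => U t + κ * m ^ 4 * t)
        (U' := fun t => U' t + κ * m ^ 4 * 1) ht
        (fun s hs => (hU s hs.1).add ((hasDerivWithinAt_id s _).const_mul _))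
        (fun s hs => by
          have h1 : m ^ 4 ≤ N s ^ 4 := by
            gcongr
            exact hmN s hs.1
          have h2 := mul_le_mul_of_nonneg_left h1 hκ.le
          linarith [hU' s hs.1])
      simpa using this
    have hU0 : 0 ≤ U 0 := he.le.trans (hcon 0 le_rfl)
    have h1 := hlin (U 0 / (κ * m ^ 4)) (by positivity)
    rw [mul_div_cancel₀ _ (by positivity)] at h1
    linarith [hcon (U 0 / (κ * m ^ 4)) (by positivity)]
  refine ⟨τ, fun t ht => ?_⟩
  rw [Real.dist_eq, sub_zero, abs_of_nonneg (hN t)]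
  have h1 : b * N t ^ 3 < b * ε ^ 3 :=
    (hlow t).trans_lt ((hanti hτ (hτ.trans ht) ht).trans_lt hUτ)
  exact lt_of_pow_lt_pow_left₀ 3 hε.le (lt_of_mul_lt_mul_left h1 hb.le)

end Decay

section ClosedLoop

open Finset Real Set

theorem rotM_inv_mulVec (ϑ : ℝ) (v : Fin 2 → ℝ) :
    (rotM ϑ)⁻¹ *ᵥ v = ![along v ϑ, across v ϑ] := by
  have h := sin_sq_add_cos_sq ϑ
  have hinv : (rotM ϑ)⁻¹ = !![cos ϑ, sin ϑ; -sin ϑ, cos ϑ] := by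
    refine Matrix.inv_eq_right_inv ?_
    ext i j
    fin_cases i <;> fin_cases j <;> simp [rotM, Matrix.mul_apply, Fin.sum_univ_two] <;> linarith
  rw [hinv]
  ext i
  fin_cases i <;> simp [along, across, Matrix.mulVec, dotProduct, Fin.sum_univ_two] <;> ring

/-- The edge weights, extended by zero to non-edges. -/
noncomputable def edgeWeight {n : ℕ} (Adj : Fin n → Fin n → Bool) (a : Fin n → Fin n → ℝ)
    (i j : Fin n) : ℝ :=
  if Adj i j = true then a i j else 0

variable {n : ℕ} {Adj : Fin n → Fin n → Bool} {a : Fin n → Fin n → ℝ}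

theorem fcons_eq_consensus (x : Fin n → Fin 2 → ℝ) :
    fcons Adj a x = consensus (edgeWeight Adj a) x := by
  ext i k
  simp only [fcons, consensus, edgeWeight, Finset.sum_apply]
  refine sum_congr rfl fun j _ => ?_
  split_ifs <;> simp

theorem uFB_smul_rotM (x : Fin n → Fin 2 → ℝ) (ϑ : ℝ) (i : Fin n) :
    uFB Adj a x ϑ i • (rotM ϑ *ᵥ ![1, 0]) = velocity (consensus (edgeWeight Adj a) x i) ϑ := by
  rw [uFB, rotM_inv_mulVec, fcons_eq_consensus, velocity]
  congr 1
  ext k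
  fin_cases k <;> simp [rotM]

theorem omegaFB_eq (k1 : ℝ) (x : Fin n → Fin 2 → ℝ) (ϑ : ℝ) (i : Fin n) :
    omegaFB k1 Adj a x ϑ i = -k1 * across (consensus (edgeWeight Adj a) x i) ϑ := by
  rw [omegaFB, rotM_inv_mulVec, fcons_eq_consensus]
  rfl

variable {ι : Type*} [Fintype ι]

/-- The closed-loop vector field on positions and headings. -/
noncomputable def closedLoopField (w : ι → ι → ℝ) (k : ℝ) (z : (ι → Fin 2 → ℝ) × (ι → ℝ)) :
    (ι → Fin 2 → ℝ) × (ι → ℝ) :=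
  (fun i => velocity (consensus w z.1 i) (z.2 i), fun i => -k * across (consensus w z.1 i) (z.2 i))

theorem isSolOn_iff {k1 : ℝ} {x : ℝ → Fin n → Fin 2 → ℝ} {θ : ℝ → Fin n → ℝ} {T : ℝ≥0∞} :
    IsSolOn Adj a k1 x θ T ↔ ∀ t : ℝ, 0 ≤ t → ENNReal.ofReal t < T →
      HasDerivWithinAt (fun s => (x s, θ s))
        (closedLoopField (edgeWeight Adj a) k1 (x t, θ t)) (Ici 0) t := by
  refine forall_congr' fun t => forall_congr' fun _ => forall_congr' fun _ => ?_
  simp only [uFB_smul_rotM, omegaFB_eq, forall_and, ← hasDerivWithinAt_pi]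
  constructor
  · rintro ⟨h1, h2⟩
    exact HasDerivWithinAt.prodMk h1 h2
  · intro h
    exact ⟨h.fst, h.snd⟩

theorem contDiff_consensus {w : ι → ι → ℝ} : ContDiff ℝ 1 (consensus w) := by
  unfold consensus
  fun_prop

/-- The closed-loop field with the speeds `‖f_i‖` replaced by independent variables. -/
noncomputable def decoupledField (w : ι → ι → ℝ) (k : ℝ)
    (p : (ι → ℝ) × ((ι → Fin 2 → ℝ) × (ι → ℝ))) : (ι → Fin 2 → ℝ) × (ι → ℝ) :=
  (fun i => (p.1 i * along (consensus w p.2.1 i) (p.2.2 i)) • ![cos (p.2.2 i), sin (p.2.2 i)],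
    fun i => -k * across (consensus w p.2.1 i) (p.2.2 i))

theorem contDiff_decoupledField (w : ι → ι → ℝ) (k : ℝ) : ContDiff ℝ 1 (decoupledField w k) := by
  have hc (i : ι) (l : Fin 2) : ContDiff ℝ 1
      fun p : (ι → ℝ) × ((ι → Fin 2 → ℝ) × (ι → ℝ)) => consensus w p.2.1 i l :=
    contDiff_pi.mp (contDiff_pi.mp (contDiff_consensus.comp (contDiff_fst.comp contDiff_snd)) i) l
  unfold decoupledField along across
  refine ContDiff.prodMk (contDiff_pi.mpr fun i => contDiff_pi.mpr fun l => ?_)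
    (contDiff_pi.mpr fun i => ?_)
  · fin_cases l
    · simp only [Pi.smul_apply, smul_eq_mul, Fin.zero_eta, Matrix.cons_val_zero]
      fun_prop
    · simp only [Pi.smul_apply, smul_eq_mul, Fin.mk_one, Matrix.cons_val_one,
        Matrix.cons_val_zero]
      fun_prop
  · fun_prop

theorem locallyLipschitz_closedLoopField (w : ι → ι → ℝ) (k : ℝ) :
    LocallyLipschitz (closedLoopField w k) := by
  have hnorm : LipschitzWith 2 fun (v : ι → Fin 2 → ℝ) i => enorm2 (v i) := by
    refine LipschitzWith.of_dist_le_mul fun u v => ?_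
    rw [NNReal.coe_ofNat, dist_eq_norm]
    refine (pi_norm_le_iff_of_nonneg (by positivity)).mpr fun i => ?_
    refine (abs_enorm2_sub_le (u i) (v i)).trans ?_
    gcongr
    exact norm_le_pi_norm (u - v) i
  have hconsensus : LocallyLipschitz fun z : (ι → Fin 2 → ℝ) × (ι → ℝ) => consensus w z.1 :=
    (contDiff_consensus.comp contDiff_fst).locallyLipschitz
  have heq : closedLoopField w k =
      decoupledField w k ∘ fun z => (fun i => enorm2 (consensus w z.1 i), z) := by
    funext z
    rfl
  have hspeed : LocallyLipschitz fun z : (ι → Fin 2 → ℝ) × (ι → ℝ) =>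
      ((fun i => enorm2 (consensus w z.1 i) : ι → ℝ), z) :=
    (hnorm.locallyLipschitz.comp hconsensus).prodMk LocallyLipschitz.id
  rw [heq]
  exact (contDiff_decoupledField w k).locallyLipschitz.comp hspeed

theorem norm_closedLoopField_le {w : ι → ι → ℝ} {k M : ℝ} {z : (ι → Fin 2 → ℝ) × (ι → ℝ)}
    (hM : ‖consensus w z.1‖ ≤ M) :
    ‖closedLoopField w k z‖ ≤ max ((2 * M) ^ 2) (|k| * (2 * M)) := by
  have hM0 : 0 ≤ M := (norm_nonneg _).trans hM
  have hr (i : ι) : enorm2 (consensus w z.1 i) ≤ 2 * M :=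
    (enorm2_apply_le _ i).trans (by gcongr)
  refine norm_prod_le_iff.mpr ⟨le_max_of_le_left ?_, le_max_of_le_right ?_⟩
  · refine (pi_norm_le_iff_of_nonneg (by positivity)).mpr fun i =>
      (pi_norm_le_iff_of_nonneg (by positivity)).mpr fun l => (abs_velocity_le _ _ _).trans ?_
    have := enorm2_nonneg (consensus w z.1 i)
    gcongr
    exact hr i
  · refine (pi_norm_le_iff_of_nonneg (by positivity)).mpr fun i => ?_
    rw [closedLoopField, norm_mul, norm_neg, Real.norm_eq_abs, Real.norm_eq_abs]
    gcongr
    refine le_trans ?_ (hr i)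
    refine abs_le_of_sq_le_sq ?_ (enorm2_nonneg _)
    rw [← along_sq_add_across_sq _ (z.2 i)]
    linarith [sq_nonneg (along (consensus w z.1 i) (z.2 i))]

theorem hasDerivWithinAt_enorm2_pow_three {f : ℝ → Fin 2 → ℝ} {g : Fin 2 → ℝ} {s : Set ℝ} {t : ℝ}
    (hf : ∀ k, HasDerivWithinAt (fun r => f r k) (g k) s t) :
    HasDerivWithinAt (fun r => enorm2 (f r) ^ 3)
      (3 * (enorm2 (f t) * (f t 0 * g 0 + f t 1 * g 1))) s t := by
  have heq (v : Fin 2 → ℝ) : enorm2 v ^ 3 = (v 0 ^ 2 + v 1 ^ 2) ^ (3 / 2 : ℝ) := by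
    rw [enorm2, Real.sqrt_eq_rpow, ← Real.rpow_natCast, ← Real.rpow_mul (by positivity)]
    norm_num
  have hq : HasDerivWithinAt (fun r => f r 0 ^ 2 + f r 1 ^ 2)
      (2 * (f t 0 * g 0 + f t 1 * g 1)) s t := by
    refine (((hf 0).fun_pow 2).fun_add ((hf 1).fun_pow 2)).congr_deriv ?_
    norm_num
    ring
  simp only [heq]
  convert hq.rpow_const (p := 3 / 2) (Or.inr (by norm_num)) using 1
  rw [enorm2, Real.sqrt_eq_rpow]
  norm_num
  ring

theorem hasDerivWithinAt_lyapunov {γ : ι → ℝ} {β k : ℝ} {f : ℝ → ι → Fin 2 → ℝ}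
    {g : ι → Fin 2 → ℝ} {θ : ℝ → ι → ℝ} {s : Set ℝ} {t : ℝ}
    (hf : ∀ i l, HasDerivWithinAt (fun r => f r i l) (g i l) s t)
    (hθ : ∀ i, HasDerivWithinAt (fun r => θ r i) (-k * across (f t i) (θ t i)) s t) :
    HasDerivWithinAt (fun r => lyapunov γ β (f r) (θ r)) (lyapunovDeriv γ β k (f t) g (θ t)) s t := by
  unfold lyapunov lyapunovDeriv
  refine HasDerivWithinAt.fun_sum fun i _ => ?_
  have h3 := (hasDerivWithinAt_enorm2_pow_three (hf i)).const_mul (γ i / 3)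
  have h2 : HasDerivWithinAt (fun r => enorm2 (f r i) ^ 2)
      (2 * (f t i 0 * g i 0 + f t i 1 * g i 1)) s t := by
    simp only [enorm2_sq]
    refine (((hf i 0).fun_pow 2).fun_add ((hf i 1).fun_pow 2)).congr_deriv ?_
    norm_num
    ring
  have h1 : HasDerivWithinAt (fun r => along (f r i) (θ r i))
      (along (g i) (θ t i) - k * across (f t i) (θ t i) ^ 2) s t := by
    unfold along
    refine (((hf i 0).fun_mul (hθ i).cos).fun_add ((hf i 1).fun_mul (hθ i).sin)).congr_deriv ?_
    unfold across
    ring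
  refine (h3.fun_add ((h2.fun_mul h1).const_mul β)).congr_deriv ?_
  ring

theorem IsSolOn.hasDerivWithinAt_lyapunov {γ : Fin n → ℝ} {β k1 : ℝ}
    {x : ℝ → Fin n → Fin 2 → ℝ} {θ : ℝ → Fin n → ℝ} {T : ℝ≥0∞} (h : IsSolOn Adj a k1 x θ T)
    {t : ℝ} (ht : 0 ≤ t) (htT : ENNReal.ofReal t < T) :
    HasDerivWithinAt (fun s => lyapunov γ β (consensus (edgeWeight Adj a) (x s)) (θ s))
      (lyapunovDeriv γ β k1 (consensus (edgeWeight Adj a) (x t))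
        (consensus (edgeWeight Adj a) fun i =>
          velocity (consensus (edgeWeight Adj a) (x t) i) (θ t i)) (θ t)) (Ici 0) t := by
  have hz := isSolOn_iff.mp h t ht htT
  have hx (i : Fin n) (l : Fin 2) := hasDerivWithinAt_pi.mp (hasDerivWithinAt_pi.mp hz.fst i) l
  refine _root_.hasDerivWithinAt_lyapunov (fun i l => ?_) (hasDerivWithinAt_pi.mp hz.snd)
  unfold consensus
  exact HasDerivWithinAt.fun_sum fun j _ => ((hx j l).sub (hx i l)).const_mul _

end ClosedLoop

section Rendezvous

open Finset Real Set Filter Topology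

variable {n : ℕ} {Adj : Fin n → Fin n → Bool} {a : Fin n → Fin n → ℝ} {k1 : ℝ}
  {x : ℝ → Fin n → Fin 2 → ℝ} {θ : ℝ → Fin n → ℝ} {T : ℝ≥0∞}

/-- A maximal solution along which the consensus field stays bounded is complete. -/
theorem IsMaxSol.eq_top_of_norm_consensus_le {M : ℝ} (h : IsMaxSol Adj a k1 x θ T)
    (hM : ∀ t : ℝ, 0 ≤ t → ENNReal.ofReal t < T → ‖consensus (edgeWeight Adj a) (x t)‖ ≤ M) :
    T = ⊤ := by
  by_contra hT
  have hlt {t : ℝ} (ht : t ∈ Ico 0 T.toReal) : ENNReal.ofReal t < T :=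
    (ENNReal.ofReal_lt_iff_lt_toReal ht.1 hT).mpr ht.2
  obtain ⟨ε, hε, y, hyz, hy⟩ :=
    (locallyLipschitz_closedLoopField (edgeWeight Adj a) k1).exists_extension
      (z := fun t => (x t, θ t)) ENNReal.toReal_nonneg
      (fun t ht => isSolOn_iff.mp h.1 t ht.1 (hlt ht))
      (fun t ht => norm_closedLoopField_le (hM t ht.1 (hlt ht)))
  refine h.2 (fun t => (y t).1) (fun t => (y t).2) (ENNReal.ofReal (T.toReal + ε)) ?_ ?_ ?_
  · rw [ENNReal.lt_ofReal_iff_toReal_lt hT]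
    linarith
  · refine isSolOn_iff.mpr fun t ht htT => hy t ⟨ht, ?_⟩
    exact (ENNReal.ofReal_lt_ofReal_iff_of_nonneg ht).mp htT
  · intro t ht htT
    have := hyz t ⟨ht, (ENNReal.ofReal_lt_iff_lt_toReal ht hT).mp htT⟩
    exact ⟨congrArg Prod.fst this, congrArg Prod.snd this⟩

end Rendezvous

/-- if the digraph (no self-loops, positive weights) is strongly
connected then there is `k1* > 0` such that for every `k1 > k1*` the proposed
feedback solves the rendezvous control problem: the rendezvous manifold is stable,
and every maximal solution is complete and satisfies `D(x(t)) → 0`. -/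
theorem rendezvous_control_strongly_connected {n : ℕ} (Adj : Fin n → Fin n → Bool)
    (hloop : ∀ i, Adj i i = false)
    (a : Fin n → Fin n → ℝ) (ha : ∀ i j, Adj i j = true → 0 < a i j)
    (hsc : ∀ i j : Fin n, Relation.ReflTransGen (fun p q => Adj p q = true) i j) :
    ∃ k1s : ℝ, 0 < k1s ∧ ∀ k1 : ℝ, k1s < k1 →
      (∀ ε : ℝ, 0 < ε → ∃ δ : ℝ, 0 < δ ∧
        ∀ (x : ℝ → Fin n → Fin 2 → ℝ) (θ : ℝ → Fin n → ℝ) (T : ℝ≥0∞),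
          IsSolOn Adj a k1 x θ T → Dmax (x 0) < δ →
            ∀ t : ℝ, 0 ≤ t → ENNReal.ofReal t < T → Dmax (x t) < ε) ∧
      (∀ (x : ℝ → Fin n → Fin 2 → ℝ) (θ : ℝ → Fin n → ℝ) (T : ℝ≥0∞),
          IsMaxSol Adj a k1 x θ T →
            T = ⊤ ∧ Filter.Tendsto (fun t => Dmax (x t)) Filter.atTop (nhds 0)) := by
  set w := edgeWeight Adj a with hwdef
  have hw (i j : Fin n) : 0 ≤ w i j := by
    rw [hwdef, edgeWeight]
    split_ifs with h
    exacts [(ha i j h).le, le_rfl]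
  have hsc' (i j : Fin n) : Relation.ReflTransGen (fun p q => 0 < w p q) i j :=
    Relation.ReflTransGen.mono (fun p q h => by
      rw [hwdef, edgeWeight, if_pos h]
      exact ha p q h) i j (hsc i j)
  obtain ⟨γ, hpos, hγ⟩ := exists_pos_left_null_laplacian hw hsc'
  obtain ⟨β, b, B, κ, ks, hb, hB, hκ, hks, hlow, hupp, hdecay⟩ :=
    exists_lyapunov_consts hw hsc' hpos hγ
  obtain ⟨C, hC, hCx⟩ := exists_abs_sub_le_mul_norm_consensus hw hsc' hpos hγ
  have hD (x : Fin n → Fin 2 → ℝ) : Dmax x ≤ 2 * (C * ‖consensus w x‖) :=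
    Dmax_le (by positivity) (hCx x)
  refine ⟨ks, hks, fun k1 hk1 => ?_⟩
  have hbound (x : ℝ → Fin n → Fin 2 → ℝ) (θ : ℝ → Fin n → ℝ) (T : ℝ≥0∞)
      (h : IsSolOn Adj a k1 x θ T) (t : ℝ) (ht : 0 ≤ t) (htT : ENNReal.ofReal t < T) :
      ‖consensus w (x t)‖ ≤ (1 + B / b) * ‖consensus w (x 0)‖ := by
    have hU := le_initial_of_hasDerivWithinAt_nonpos ht
      (fun s hs => h.hasDerivWithinAt_lyapunov (γ := γ) (β := β) hs.1
        ((ENNReal.ofReal_le_ofReal hs.2).trans_lt htT))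
      (fun s _ => (hdecay k1 hk1 _ (θ s) (sum_mul_consensus_eq_zero hγ (x s))).trans (by
        have := mul_nonneg hκ.le (pow_nonneg (norm_nonneg (consensus w (x s))) 4)
        linarith))
    have hcube : b * ‖consensus w (x t)‖ ^ 3 ≤ B * ‖consensus w (x 0)‖ ^ 3 :=
      (hlow _ (θ t)).trans (hU.trans (hupp _ (θ 0)))
    have hratio : 0 ≤ B / b := by positivity
    refine le_of_pow_le_pow_left₀ three_ne_zero (by positivity) ?_
    calc ‖consensus w (x t)‖ ^ 3 ≤ B / b * ‖consensus w (x 0)‖ ^ 3 := by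
          rw [div_mul_eq_mul_div, le_div_iff₀ hb]
          linarith
      _ ≤ (1 + B / b) ^ 3 * ‖consensus w (x 0)‖ ^ 3 := by
          gcongr
          nlinarith [pow_nonneg hratio 2, pow_nonneg hratio 3]
      _ = _ := by ring
  refine ⟨fun ε hε => ?_, fun x θ T h => ?_⟩
  · set K := 2 * (C * ((1 + B / b) * ∑ i, ∑ j, w i j)) with hK
    have hK0 : 0 ≤ K := by
      have := Finset.sum_nonneg fun i (_ : i ∈ Finset.univ) =>
        Finset.sum_nonneg fun j (_ : j ∈ Finset.univ) => hw i j
      positivity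
    refine ⟨ε / (K + 1), by positivity, fun x θ T h h0 t ht htT => ?_⟩
    rw [lt_div_iff₀ (by positivity)] at h0
    calc Dmax (x t) ≤ 2 * (C * ‖consensus w (x t)‖) := hD _
      _ ≤ 2 * (C * ((1 + B / b) * ((∑ i, ∑ j, w i j) * Dmax (x 0)))) := by
          gcongr
          refine (hbound x θ T h t ht htT).trans ?_
          gcongr
          exact norm_consensus_le_mul_Dmax hw (x 0)
      _ = K * Dmax (x 0) := by rw [hK]; ring
      _ ≤ Dmax (x 0) * (K + 1) := by linarith [Dmax_nonneg (x 0)]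
      _ < ε := h0
  · obtain rfl : T = ⊤ := h.eq_top_of_norm_consensus_le (hbound x θ T h.1)
    refine ⟨rfl, ?_⟩
    have hlim := tendsto_zero_of_cubic_lyapunov hb hB hκ
      (N := fun t => ‖consensus w (x t)‖) (fun _ => norm_nonneg _)
      (fun t => hlow (consensus w (x t)) (θ t)) (fun t => hupp _ _)
      (fun t ht => h.1.hasDerivWithinAt_lyapunov ht ENNReal.ofReal_lt_top)
      (fun t _ => hdecay k1 hk1 _ (θ t) (sum_mul_consensus_eq_zero hγ (x t)))
    refine squeeze_zero (fun t => Dmax_nonneg _) (fun t => hD (x t)) ?_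
    simpa using (hlim.const_mul C).const_mul 2
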